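/- The Couette analytical solution solves the diffusion equation: let H > 0, μ > 0, λ_k = kπ/H, and define u*(t,y) = y/H + 2 ∑_{k=1}^{∞} ((−1)^k/(λ_k H)) exp(−μ λ_k² t) sin(λ_k y) on (0,∞) × ℝ. Then u* is smooth on (0,∞) × ℝ and satisfies ∂u*/∂t = μ ∂²u*/∂y² at every point (t,y) with t > 0. -/

import Mathlib

open Real Set

/-- The coefficients `a` are tame if damping them by the heat factors `exp (-μ λ_k² ε)` makes them
absolutely summable for every positive time `ε`. -/
def HeatTame (μ : ℝ) (lam a : ℕ → ℝ) : Prop :=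
  ∀ ε : ℝ, 0 < ε → Summable fun k => |a k| * Real.exp (-μ * lam k ^ 2 * ε)

/-- The solution `∑ a_k exp (-μ λ_k² t) sin (λ_k y + φ)` of the heat equation. -/
noncomputable def heatSeries (μ : ℝ) (lam a : ℕ → ℝ) (φ : ℝ) (p : ℝ × ℝ) : ℝ :=
  ∑' k, a k * Real.exp (-μ * lam k ^ 2 * p.1) * Real.sin (lam k * p.2 + φ)

lemma HeatTame.sq_mul {μ : ℝ} {lam a : ℕ → ℝ} (hμ : 0 < μ) (ha : HeatTame μ lam a) :
    HeatTame μ lam fun k => lam k ^ 2 * a k := by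
  intro ε hε
  refine Summable.of_nonneg_of_le (fun k => by positivity) (fun k => ?_)
    ((ha (ε / 2) (by positivity)).mul_left (2 / (μ * ε)))
  have h1 : μ * lam k ^ 2 * ε / 2 ≤ Real.exp (μ * lam k ^ 2 * ε / 2) := by
    linarith [Real.add_one_le_exp (μ * lam k ^ 2 * ε / 2)]
  have h2 : Real.exp (-μ * lam k ^ 2 * (ε / 2)) =
      Real.exp (μ * lam k ^ 2 * ε / 2) * Real.exp (-μ * lam k ^ 2 * ε) := by
    rw [← Real.exp_add]; ring_nf
  rw [abs_mul, abs_of_nonneg (sq_nonneg (lam k)), h2]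
  calc lam k ^ 2 * |a k| * Real.exp (-μ * lam k ^ 2 * ε)
      = 2 / (μ * ε) * (|a k| * ((μ * lam k ^ 2 * ε / 2) * Real.exp (-μ * lam k ^ 2 * ε))) := by
        field_simp
    _ ≤ _ := by gcongr

lemma HeatTame.mul {μ : ℝ} {lam a : ℕ → ℝ} (hμ : 0 < μ) (ha : HeatTame μ lam a) :
    HeatTame μ lam fun k => lam k * a k := by
  intro ε hε
  refine Summable.of_nonneg_of_le (fun k => by positivity) (fun k => ?_)
    ((ha ε hε).add (ha.sq_mul hμ ε hε))
  have h : |lam k| ≤ 1 + lam k ^ 2 := by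
    rw [← sq_abs (lam k)]; nlinarith [sq_nonneg (|lam k| - 1), abs_nonneg (lam k)]
  rw [abs_mul, abs_mul, abs_of_nonneg (sq_nonneg (lam k)), ← add_mul]
  gcongr
  nlinarith [mul_le_mul_of_nonneg_right h (abs_nonneg (a k))]

lemma HeatTame.const_mul {μ : ℝ} {lam a : ℕ → ℝ} (ha : HeatTame μ lam a) (c : ℝ) :
    HeatTame μ lam fun k => c * a k := by
  intro ε hε
  simpa only [abs_mul, mul_assoc] using (ha ε hε).mul_left |c|

lemma abs_heatTerm_le {μ ε l b φ : ℝ} {p : ℝ × ℝ} (hμ : 0 < μ) (hp : ε ≤ p.1) :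
    |b * Real.exp (-μ * l ^ 2 * p.1) * Real.sin (l * p.2 + φ)| ≤
      |b| * Real.exp (-μ * l ^ 2 * ε) := by
  rw [abs_mul, abs_mul, Real.abs_exp]
  have h : Real.exp (-μ * l ^ 2 * p.1) ≤ Real.exp (-μ * l ^ 2 * ε) := by
    apply Real.exp_le_exp.2
    have := mul_le_mul_of_nonneg_left hp (by positivity : 0 ≤ μ * l ^ 2)
    linarith
  calc |b| * Real.exp (-μ * l ^ 2 * p.1) * |Real.sin (l * p.2 + φ)|
      ≤ |b| * Real.exp (-μ * l ^ 2 * ε) * 1 := by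
        gcongr
        exact Real.abs_sin_le_one _
    _ = _ := mul_one _

lemma HeatTame.summable {μ : ℝ} {lam a : ℕ → ℝ} (hμ : 0 < μ) (ha : HeatTame μ lam a) (φ : ℝ)
    {p : ℝ × ℝ} (hp : 0 < p.1) :
    Summable fun k => a k * Real.exp (-μ * lam k ^ 2 * p.1) * Real.sin (lam k * p.2 + φ) :=
  .of_norm_bounded (ha p.1 hp) fun _ => abs_heatTerm_le hμ le_rfl

lemma hasFDerivAt_heatTerm (μ l b φ : ℝ) (p : ℝ × ℝ) :
    HasFDerivAt (fun p : ℝ × ℝ => b * Real.exp (-μ * l ^ 2 * p.1) * Real.sin (l * p.2 + φ))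
      (((-μ * (l ^ 2 * b)) * Real.exp (-μ * l ^ 2 * p.1) * Real.sin (l * p.2 + φ)) •
          ContinuousLinearMap.fst ℝ ℝ ℝ +
        ((l * b) * Real.exp (-μ * l ^ 2 * p.1) * Real.sin (l * p.2 + (φ + π / 2))) •
          ContinuousLinearMap.snd ℝ ℝ ℝ) p := by
  have h1 : HasFDerivAt (fun p : ℝ × ℝ => p.1) (ContinuousLinearMap.fst ℝ ℝ ℝ) p :=
    hasFDerivAt_fst
  have h2 : HasFDerivAt (fun p : ℝ × ℝ => p.2) (ContinuousLinearMap.snd ℝ ℝ ℝ) p :=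
    hasFDerivAt_snd
  refine (((h1.const_mul (-μ * l ^ 2)).exp.const_mul b).mul
    ((h2.const_mul l).add_const φ).sin).congr_fderiv ?_
  rw [← add_assoc, Real.sin_add_pi_div_two]
  ext <;> simp <;> ring

lemma hasFDerivAt_heatSeries {μ : ℝ} {lam a : ℕ → ℝ} (hμ : 0 < μ) (ha : HeatTame μ lam a) (φ : ℝ)
    {p : ℝ × ℝ} (hp : 0 < p.1) :
    HasFDerivAt (heatSeries μ lam a φ)
      (heatSeries μ lam (fun k => -μ * (lam k ^ 2 * a k)) φ p • ContinuousLinearMap.fst ℝ ℝ ℝ +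
        heatSeries μ lam (fun k => lam k * a k) (φ + π / 2) p •
          ContinuousLinearMap.snd ℝ ℝ ℝ) p := by
  have h1 : HeatTame μ lam (fun k => -μ * (lam k ^ 2 * a k)) := (ha.sq_mul hμ).const_mul _
  have h2 : HeatTame μ lam (fun k => lam k * a k) := ha.mul hμ
  have hε : 0 < p.1 / 2 := by positivity
  have hps : p ∈ Ioi (p.1 / 2) ×ˢ (univ : Set ℝ) := ⟨half_lt_self hp, mem_univ _⟩
  have key := hasFDerivAt_tsum_of_isPreconnected ((h1 _ hε).add (h2 _ hε))
    (isOpen_Ioi.prod isOpen_univ) (isPreconnected_Ioi.prod isPreconnected_univ)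
    (fun k x _ => hasFDerivAt_heatTerm μ (lam k) (a k) φ x)
    (fun k x hx => ?_) hps (ha.summable hμ φ hp) hps
  · refine key.congr_fderiv ?_
    have s1 := h1.summable hμ φ hp
    have s2 := h2.summable hμ (φ + π / 2) hp
    rw [Summable.tsum_add (s1.smul_const _) (s2.smul_const _), s1.tsum_smul_const,
      s2.tsum_smul_const]
    rfl
  · refine (norm_add_le _ _).trans (add_le_add ?_ ?_) <;> rw [norm_smul]
    · exact (mul_le_of_le_one_right (norm_nonneg _) (ContinuousLinearMap.norm_fst_le ℝ ℝ ℝ)).trans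
        (abs_heatTerm_le hμ hx.1.le)
    · exact (mul_le_of_le_one_right (norm_nonneg _) (ContinuousLinearMap.norm_snd_le ℝ ℝ ℝ)).trans
        (abs_heatTerm_le hμ hx.1.le)

lemma contDiffOn_heatSeries {μ : ℝ} {lam a : ℕ → ℝ} (hμ : 0 < μ) (ha : HeatTame μ lam a) (φ : ℝ) :
    ContDiffOn ℝ (⊤ : ℕ∞) (heatSeries μ lam a φ) (Ioi (0 : ℝ) ×ˢ univ) := by
  rw [contDiffOn_infty]
  intro n
  induction n generalizing a φ with
  | zero =>
    exact contDiffOn_zero.2 fun p hp =>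
      (hasFDerivAt_heatSeries hμ ha φ hp.1).continuousAt.continuousWithinAt
  | succ n ih =>
    push_cast
    rw [contDiffOn_succ_iff_hasFDerivWithinAt_of_uniqueDiffOn
      (isOpen_Ioi.prod isOpen_univ).uniqueDiffOn]
    exact ⟨fun h => by simp at h, _,
      ((ih ((ha.sq_mul hμ).const_mul (-μ)) φ).smul contDiffOn_const).add
        ((ih (ha.mul hμ) (φ + π / 2)).smul contDiffOn_const),
      fun p hp => (hasFDerivAt_heatSeries hμ ha φ hp.1).hasFDerivWithinAt⟩

lemma hasDerivAt_heatSeries_time {μ : ℝ} {lam a : ℕ → ℝ} (hμ : 0 < μ) (ha : HeatTame μ lam a)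
    (φ y : ℝ) {t : ℝ} (ht : 0 < t) :
    HasDerivAt (fun s => heatSeries μ lam a φ (s, y))
      (heatSeries μ lam (fun k => -μ * (lam k ^ 2 * a k)) φ (t, y)) t := by
  simpa [Function.comp_def] using (hasFDerivAt_heatSeries hμ ha φ (p := (t, y)) ht).comp_hasDerivAt t
    ((hasDerivAt_id t).prodMk (hasDerivAt_const t y))

lemma hasDerivAt_heatSeries_space {μ : ℝ} {lam a : ℕ → ℝ} (hμ : 0 < μ) (ha : HeatTame μ lam a)
    (φ y : ℝ) {t : ℝ} (ht : 0 < t) :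
    HasDerivAt (fun z => heatSeries μ lam a φ (t, z))
      (heatSeries μ lam (fun k => lam k * a k) (φ + π / 2) (t, y)) y := by
  simpa [Function.comp_def] using (hasFDerivAt_heatSeries hμ ha φ (p := (t, y)) ht).comp_hasDerivAt y
    ((hasDerivAt_const y t).prodMk (hasDerivAt_id y))

lemma heatSeries_second_space_deriv (μ : ℝ) (lam a : ℕ → ℝ) (φ : ℝ) (p : ℝ × ℝ) :
    heatSeries μ lam (fun k => -μ * (lam k ^ 2 * a k)) φ p =
      μ * heatSeries μ lam (fun k => lam k * (lam k * a k)) (φ + π / 2 + π / 2) p := by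
  unfold heatSeries
  rw [← tsum_mul_left]
  refine tsum_congr fun k => ?_
  rw [show lam k * p.2 + (φ + π / 2 + π / 2) = lam k * p.2 + φ + π by ring, Real.sin_add_pi]
  ring

lemma heatTame_of_bounded {μ c C : ℝ} (hμ : 0 < μ) (hc : 0 < c) {lam a : ℕ → ℝ}
    (hlam : ∀ k, lam k = (k + 1) * c) (ha : ∀ k, |a k| ≤ C) : HeatTame μ lam a := by
  intro ε hε
  have hd : 0 < μ * c ^ 2 * ε := by positivity
  refine Summable.of_nonneg_of_le (fun k => by positivity) (fun k => ?_)
    ((Real.summable_exp_nat_mul_iff.2 (neg_lt_zero.2 hd)).mul_left C)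
  refine mul_le_mul (ha k) (Real.exp_le_exp.2 ?_) (Real.exp_nonneg _)
    ((abs_nonneg _).trans (ha k))
  have hk : (k : ℝ) ≤ (k + 1) ^ 2 := by nlinarith [(Nat.cast_nonneg k : (0 : ℝ) ≤ k)]
  rw [hlam]
  nlinarith [mul_le_mul_of_nonneg_right hk hd.le]

/-- The Couette analytical solution
`u*(t,y) = y/H + 2 ∑_{k≥1} ((−1)^k/(λ_k H)) exp(−μ λ_k² t) sin(λ_k y)`
is smooth on `(0,∞) × ℝ` and solves the diffusion equation
`∂u*/∂t = μ ∂²u*/∂y²` at every point with `t > 0`. -/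
theorem couette_solution_solves_diffusion (H μ : ℝ) (hH : 0 < H) (hμ : 0 < μ)
    (lam : ℕ → ℝ) (hlam : ∀ k : ℕ, lam k = k * Real.pi / H)
    (u : ℝ → ℝ → ℝ)
    (hu : ∀ t y : ℝ, u t y = y / H + 2 * ∑' k : ℕ,
      ((-1 : ℝ) ^ (k + 1) / (lam (k + 1) * H)) *
        Real.exp (-μ * lam (k + 1) ^ 2 * t) * Real.sin (lam (k + 1) * y)) :
    ContDiffOn ℝ (⊤ : ℕ∞) (fun p : ℝ × ℝ => u p.1 p.2) (Set.Ioi (0 : ℝ) ×ˢ Set.univ) ∧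
    (∀ t y : ℝ, 0 < t →
      deriv (fun s : ℝ => u s y) t = μ * deriv (deriv (fun z : ℝ => u t z)) y) := by
  set l : ℕ → ℝ := fun k => lam (k + 1) with hl
  set a : ℕ → ℝ := fun k => (-1 : ℝ) ^ (k + 1) / (lam (k + 1) * H) with ha_def
  have hlk : ∀ k, l k = (k + 1) * (π / H) := fun k => by
    simp only [hl, hlam]; push_cast; ring
  have ha : HeatTame μ l a := by
    refine heatTame_of_bounded (C := 1 / π) hμ (by positivity) hlk fun k => ?_
    have h : lam (k + 1) * H = (k + 1) * π := by
      rw [hlam]; push_cast; field_simp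
    rw [ha_def]
    simp only [h, abs_div, abs_pow, abs_neg, abs_one, one_pow]
    rw [abs_of_pos (by positivity)]
    exact one_div_le_one_div_of_le pi_pos (le_mul_of_one_le_left pi_pos.le (by simp))
  have hu' : ∀ t y, u t y = y / H + 2 * heatSeries μ l a 0 (t, y) := fun t y => by
    simp [hu, heatSeries, hl, ha_def]
  refine ⟨?_, fun t y ht => ?_⟩
  · simp only [hu', Prod.mk.eta]
    exact (contDiff_snd.div_const H).contDiffOn.add
      (contDiffOn_const.mul (contDiffOn_heatSeries hμ ha 0))
  · simp only [hu']
    rw [(((hasDerivAt_heatSeries_time hμ ha 0 y ht).const_mul 2).const_add (y / H)).deriv]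
    have h1 : deriv (fun z => z / H + 2 * heatSeries μ l a 0 (t, z)) =
        fun z => 1 / H + 2 * heatSeries μ l (fun k => l k * a k) (0 + π / 2) (t, z) := by
      funext z
      exact (((hasDerivAt_id z).div_const H).add
        ((hasDerivAt_heatSeries_space hμ ha 0 z ht).const_mul 2)).deriv
    rw [h1, (((hasDerivAt_heatSeries_space hμ (ha.mul hμ) (0 + π / 2) y ht).const_mul
      2).const_add (1 / H)).deriv, heatSeries_second_space_deriv]
    ring
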